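/- arXiv:1507.03412 — 5 statements merged into one kernel-verified Lean document; each statement's English description precedes it below -/
import Mathlib

section
/- Let m ≥ 2 and n ≥ 1 be integers and Q = (𝒜, ℬ, 𝒞) a triplet of m-th order n-dimensional real tensors. A real number λ is an m-degree Pareto-eigenvalue of Q if and only if there exist a nonempty subset J ⊆ {1,…,n} and a vector x ∈ ℝ^n with x_i > 0 for all i ∈ J and x_i = 0 for all i ∉ J, such that ((λ^m 𝒜 + λ ℬ + 𝒞)x^{m-1})_i = 0 for every i ∈ J and ((λ^m 𝒜 + λ ℬ + 𝒞)x^{m-1})_i ≥ 0 for every i ∉ J. Moreover, in that case such a vector x is a Pareto-eigenvector of Q associated to λ. -/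
open Finset

/-- `𝒜x^{m-1}` for an `(k+1)`-th order `n`-dimensional tensor `A`. -/
noncomputable def tApply {n k : ℕ} (A : (Fin (k + 1) → Fin n) → ℝ) (x : Fin n → ℝ) :
    Fin n → ℝ :=
  fun i => ∑ g : Fin k → Fin n, A (Fin.cons i g) * ∏ j, x (g j)

/-- `𝒜x^m` for an `m`-th order `n`-dimensional tensor `A`. -/
noncomputable def tEval {n m : ℕ} (A : (Fin m → Fin n) → ℝ) (x : Fin n → ℝ) : ℝ :=
  ∑ f : Fin m → Fin n, A f * ∏ j, x (f j)

/-- the tensor `λ^m 𝒜 + λ ℬ + 𝒞` where `m = k + 2`. -/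
noncomputable def triple {n k : ℕ} (A B C : (Fin (k + 2) → Fin n) → ℝ) (lam : ℝ) :
    (Fin (k + 2) → Fin n) → ℝ :=
  fun f => lam ^ (k + 2) * A f + lam * B f + C f

/-- `(λ, x)` is an `m`-degree Pareto-eigenpair of the triplet `(A, B, C)`, `m = k + 2`. -/
noncomputable def IsParetoPair {n k : ℕ} (A B C : (Fin (k + 2) → Fin n) → ℝ)
    (lam : ℝ) (x : Fin n → ℝ) : Prop :=
  x ≠ 0 ∧ (∀ i, 0 ≤ x i) ∧ (∀ i, 0 ≤ tApply (triple A B C lam) x i) ∧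
    (∑ i, x i * tApply (triple A B C lam) x i) = 0

/-- A vector positive on a nonempty set `J` and vanishing off `J`, whose image under the pencil
vanishes on `J` and is nonnegative off `J`, is a Pareto-eigenvector. -/
theorem isParetoPair_of_support {n k : ℕ} {A B C : (Fin (k + 2) → Fin n) → ℝ} {lam : ℝ}
    {J : Finset (Fin n)} (hJ : J.Nonempty) {x : Fin n → ℝ}
    (hpos : ∀ i ∈ J, 0 < x i) (hzero : ∀ i ∉ J, x i = 0)
    (hon : ∀ i ∈ J, tApply (triple A B C lam) x i = 0)
    (hoff : ∀ i ∉ J, 0 ≤ tApply (triple A B C lam) x i) :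
    IsParetoPair A B C lam x := by
  refine ⟨?_, fun i => ?_, fun i => ?_, Finset.sum_eq_zero fun i _ => ?_⟩
  · rintro rfl
    obtain ⟨i, hi⟩ := hJ
    exact lt_irrefl _ (hpos i hi)
  all_goals by_cases hi : i ∈ J
  · exact (hpos i hi).le
  · exact (hzero i hi).ge
  · exact (hon i hi).ge
  · exact hoff i hi
  · rw [hon i hi, mul_zero]
  · rw [hzero i hi, zero_mul]

/-- Characterization of the `m`-degree Pareto-eigenvalues of `Q = (A, B, C)`:  `λ` is an
`m`-degree Pareto-eigenvalue iff there are a nonempty `J ⊆ [n]` and a vector `x` positive on `J`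
and vanishing off `J` such that `((λ^m A + λ B + C)x^{m-1})_i = 0` on `J` and `≥ 0` off `J`;
moreover any such `x` is a Pareto-eigenvector associated to `λ`. -/
theorem pareto_eigenvalue_characterization (k n : ℕ) (hn : 1 ≤ n)
    (A B C : (Fin (k + 2) → Fin n) → ℝ) (lam : ℝ) :
    ((∃ x : Fin n → ℝ, IsParetoPair A B C lam x) ↔
      ∃ J : Finset (Fin n), J.Nonempty ∧ ∃ x : Fin n → ℝ,
        (∀ i ∈ J, 0 < x i) ∧ (∀ i ∉ J, x i = 0) ∧
        (∀ i ∈ J, tApply (triple A B C lam) x i = 0) ∧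
        (∀ i ∉ J, 0 ≤ tApply (triple A B C lam) x i)) ∧
    (∀ J : Finset (Fin n), J.Nonempty → ∀ x : Fin n → ℝ,
        (∀ i ∈ J, 0 < x i) → (∀ i ∉ J, x i = 0) →
        (∀ i ∈ J, tApply (triple A B C lam) x i = 0) →
        (∀ i ∉ J, 0 ≤ tApply (triple A B C lam) x i) →
        IsParetoPair A B C lam x) := by
  refine ⟨⟨?_, ?_⟩, fun J hJ x => isParetoPair_of_support hJ⟩
  · rintro ⟨x, hne, hx, hy, hsum⟩
    rw [Finset.sum_eq_zero_iff_of_nonneg fun i _ => mul_nonneg (hx i) (hy i)] at hsum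
    refine ⟨Finset.univ.filter fun i => 0 < x i, ?_, x, fun i hi => ?_, fun i hi => ?_, fun i hi => ?_,
      fun i _ => hy i⟩
    · obtain ⟨i, hi⟩ := Function.ne_iff.mp hne
      exact ⟨i, by simpa using (hx i).lt_of_ne' hi⟩
    · simpa using hi
    · exact le_antisymm (by simpa using hi) (hx i)
    · have hi' : 0 < x i := by simpa using hi
      exact (mul_eq_zero.mp (hsum i (Finset.mem_univ i))).resolve_left hi'.ne'
  · rintro ⟨J, hJ, x, hpos, hzero, hon, hoff⟩
    exact ⟨x, isParetoPair_of_support hJ hpos hzero hon hoff⟩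
end

section
/- Let m ≥ 2, n ≥ 1, p ≥ 1 be integers, let η_1,…,η_p ∈ ℝ^n be linearly independent, let K = {H^⊤α : α ∈ ℝ^p_+} where H is the p×n matrix with rows η_1^⊤,…,η_p^⊤, and let Q = (𝒜, ℬ, 𝒞) be a triplet of m-th order n-dimensional real tensors. Define m-th order p-dimensional tensors 𝒟, 𝒢, 𝒮 by d_{i_1…i_m} = ∑_{j_1,…,j_m=1}^n a_{j_1…j_m} h_{i_1 j_1}⋯h_{i_m j_m}, g_{i_1…i_m} = ∑_{j_1,…,j_m=1}^n b_{j_1…j_m} h_{i_1 j_1}⋯h_{i_m j_m}, and s_{i_1…i_m} = ∑_{j_1,…,j_m=1}^n c_{j_1…j_m} h_{i_1 j_1}⋯h_{i_m j_m}. Then (λ, x) with x ∈ ℝ^n \ {0} is an m-degree K-eigenpair of Q if and only if there exists α ∈ ℝ^p_+ \ {0} with x = H^⊤α such that (λ, α) is an m-degree Pareto-eigenpair of (𝒟, 𝒢, 𝒮). In particular σ(Q, K) = σ((𝒟,𝒢,𝒮), ℝ^p_+). -/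
open Finset

/-- the `m`-degree `K`-spectrum `σ(Q, K)` of the triplet `Q = (A, B, C)`, `m = k + 2`. -/
noncomputable def spec {n k : ℕ} (A B C : (Fin (k + 2) → Fin n) → ℝ)
    (K : Set (Fin n → ℝ)) : Set ℝ :=
  {lam | ∃ x : Fin n → ℝ, x ≠ 0 ∧ x ∈ K ∧
    (∀ y ∈ K, 0 ≤ ∑ i, tApply (triple A B C lam) x i * y i) ∧
    (∑ i, x i * tApply (triple A B C lam) x i) = 0}

/-- the transformed `m`-th order `p`-dimensional tensor with entries
`∑_{j_1,…,j_m} a_{j_1…j_m} h_{i_1 j_1} ⋯ h_{i_m j_m}`, where `h_{i j} = η_i j`. -/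
noncomputable def pushTensor {n p m : ℕ} (η : Fin p → Fin n → ℝ)
    (A : (Fin m → Fin n) → ℝ) : (Fin m → Fin p) → ℝ :=
  fun f => ∑ g : Fin m → Fin n, A g * ∏ t, η (f t) (g t)

theorem triple_pushTensor {n p k : ℕ} (η : Fin p → Fin n → ℝ)
    (A B C : (Fin (k + 2) → Fin n) → ℝ) (lam : ℝ) :
    triple (pushTensor η A) (pushTensor η B) (pushTensor η C) lam =
      pushTensor η (triple A B C lam) := by
  funext f
  simp only [triple, pushTensor, mul_sum, ← sum_add_distrib]
  exact sum_congr rfl fun g _ => by ring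

theorem tApply_pushTensor {n p k : ℕ} (η : Fin p → Fin n → ℝ)
    (T : (Fin (k + 1) → Fin n) → ℝ) (α : Fin p → ℝ) (i : Fin p) :
    tApply (pushTensor η T) α i = ∑ l, η i l * tApply T (∑ j, α j • η j) l := by
  have hsum (g : Fin k → Fin p) : pushTensor η T (Fin.cons i g) =
      ∑ l, ∑ h : Fin k → Fin n, T (Fin.cons l h) * (η i l * ∏ t, η (g t) (h t)) := by
    rw [pushTensor, ← (Fin.consEquiv fun _ => Fin n).sum_comp, Fintype.sum_prod_type]
    simp [Fin.consEquiv, Fin.prod_univ_succ]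
  have hprod (h : Fin k → Fin n) : ∏ t, (∑ j, α j • η j) (h t) =
      ∑ g : Fin k → Fin p, ∏ t, α (g t) * η (g t) (h t) := by
    simp only [Finset.sum_apply, Pi.smul_apply, smul_eq_mul]
    exact Fintype.prod_sum fun t j => α j * η j (h t)
  simp only [tApply, hsum, hprod, sum_mul, mul_sum, prod_mul_distrib]
  rw [sum_comm]
  refine sum_congr rfl fun l _ => ?_
  rw [sum_comm]
  exact sum_congr rfl fun h _ => sum_congr rfl fun g _ => by ring

theorem sum_mul_tApply_pushTensor {n p k : ℕ} (η : Fin p → Fin n → ℝ)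
    (T : (Fin (k + 1) → Fin n) → ℝ) (α β : Fin p → ℝ) :
    ∑ i, (∑ j, β j • η j) i * tApply T (∑ j, α j • η j) i =
      ∑ j, β j * tApply (pushTensor η T) α j := by
  simp only [tApply_pushTensor, Finset.sum_apply (g := fun j => β j • η j), Pi.smul_apply,
    smul_eq_mul, sum_mul, mul_sum]
  rw [sum_comm]
  simp only [mul_assoc]

/-- The dual-cone and orthogonality conditions at `H^⊤α` for the cone generated by the rows of `H`
are those at `α` for the nonnegative orthant and the transformed tensor. -/
theorem dual_and_orthogonal_iff {n p k : ℕ} (η : Fin p → Fin n → ℝ)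
    (T : (Fin (k + 1) → Fin n) → ℝ) (α : Fin p → ℝ) :
    ((∀ y ∈ {x | ∃ β : Fin p → ℝ, (∀ j, 0 ≤ β j) ∧ x = ∑ j, β j • η j},
        0 ≤ ∑ i, tApply T (∑ j, α j • η j) i * y i) ∧
      ∑ i, (∑ j, α j • η j) i * tApply T (∑ j, α j • η j) i = 0) ↔
    (∀ i, 0 ≤ tApply (pushTensor η T) α i) ∧
      ∑ i, α i * tApply (pushTensor η T) α i = 0 := by
  rw [sum_mul_tApply_pushTensor]
  refine and_congr_left fun _ => ⟨fun h i => ?_, ?_⟩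
  · have hi := h (∑ j, (Pi.single i 1 : Fin p → ℝ) j • η j)
      ⟨Pi.single i 1, fun j => by by_cases hj : j = i <;> simp [hj], rfl⟩
    simp_rw [mul_comm (tApply T _ _)] at hi
    rw [sum_mul_tApply_pushTensor] at hi
    simpa [Pi.single_apply] using hi
  · rintro h _ ⟨β, hβ, rfl⟩
    simp_rw [mul_comm (tApply T _ _)]
    rw [sum_mul_tApply_pushTensor]
    exact sum_nonneg fun j _ => mul_nonneg (hβ j) (h j)

/-- For the finitely generated cone `K = {H^⊤α : α ≥ 0}` with linearly independent rows
`η_1, …, η_p` of `H`, `(λ, x)` with `x ≠ 0` is an `m`-degree `K`-eigenpair of `(A, B, C)` iff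
`x = H^⊤α` for some nonzero `α ≥ 0` such that `(λ, α)` is an `m`-degree Pareto-eigenpair of
the transformed triplet `(D, G, S)`; in particular `σ((A,B,C), K) = σ((D,G,S), ℝ^p_+)`. -/
theorem polyhedral_eigenpair_reduction (k n p : ℕ) (hn : 1 ≤ n) (hp : 1 ≤ p)
    (η : Fin p → Fin n → ℝ) (hη : LinearIndependent ℝ η)
    (K : Set (Fin n → ℝ))
    (hK : K = {x | ∃ α : Fin p → ℝ, (∀ j, 0 ≤ α j) ∧ x = ∑ j, α j • η j})
    (A B C : (Fin (k + 2) → Fin n) → ℝ) :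
    (∀ (lam : ℝ) (x : Fin n → ℝ), x ≠ 0 →
      ((x ∈ K ∧
        (∀ y ∈ K, 0 ≤ ∑ i, tApply (triple A B C lam) x i * y i) ∧
        (∑ i, x i * tApply (triple A B C lam) x i) = 0) ↔
       (∃ α : Fin p → ℝ, (∀ j, 0 ≤ α j) ∧ α ≠ 0 ∧ x = ∑ j, α j • η j ∧
        IsParetoPair (pushTensor η A) (pushTensor η B) (pushTensor η C) lam α))) ∧
    spec A B C K =
      {lam : ℝ | ∃ α : Fin p → ℝ,
        IsParetoPair (pushTensor η A) (pushTensor η B) (pushTensor η C) lam α} := by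
  subst hK
  refine (and_iff_left_of_imp fun key => Set.ext fun lam => ⟨?_, ?_⟩).2 fun lam x hx => ⟨?_, ?_⟩
  · rintro ⟨x, hx, h⟩
    obtain ⟨α, -, -, -, h'⟩ := (key lam x hx).1 h
    exact ⟨α, h'⟩
  · rintro ⟨α, h⟩
    have hx : ∑ j, α j • η j ≠ 0 := fun h0 =>
      h.1 (funext (Fintype.linearIndependent_iff.1 hη α h0))
    exact ⟨_, hx, (key lam _ hx).2 ⟨α, h.2.1, h.1, rfl, h⟩⟩
  · rintro ⟨⟨α, hα, rfl⟩, h⟩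
    have hα0 : α ≠ 0 := by
      rintro rfl
      simp at hx
    refine ⟨α, hα, hα0, rfl, hα0, hα, ?_⟩
    rw [triple_pushTensor]
    exact (dual_and_orthogonal_iff η _ α).1 h
  · rintro ⟨α, hα, -, rfl, -, -, h⟩
    rw [triple_pushTensor] at h
    exact ⟨⟨α, hα, rfl⟩, (dual_and_orthogonal_iff η _ α).2 h⟩
end

section
/- Let m ≥ 2 and n ≥ 1 be integers and let 𝒜, ℬ be symmetric m-th order n-dimensional real tensors. Suppose (ū, v̄) ∈ ℝ^n_+ × ℝ^n_+ satisfies 𝒜ū^m + ∑_{i=1}^n v̄_i^m = 1 and ū ≠ 0, and suppose (ū, v̄) is a stationary point of the problem max{φ₀(u,v) : (u,v) ∈ F}, i.e., there exist ᾱ, β̄ ∈ ℝ^n and γ̄ ∈ ℝ such that mℬū^{m-1} − m(m-1)^{1/m} diag(v̄)ū^{[m-2]} = ᾱ + γ̄ m 𝒜ū^{m-1}, −m(m-1)^{1/m − 1} ū^{[m-1]} = β̄ + γ̄ m v̄^{[m-1]}, ᾱ ≥ 0 with ᾱ^⊤ū = 0, and β̄ ≥ 0 with β̄^⊤v̄ =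 0. Then φ₀(ū, v̄) = −γ̄ > 0, and (λ̄, ū) with λ̄ = (φ₀(ū, v̄))^{1/(m-1)} is an m-degree Pareto-eigenpair of the triplet (𝒜, ℬ, −ℐ). -/
open Finset

/-- the unit tensor `ℐ`: entries `1` if all indices coincide and `0` otherwise. -/
noncomputable def unitT {n k : ℕ} : (Fin (k + 2) → Fin n) → ℝ :=
  fun f => if ∀ t, f t = f 0 then 1 else 0

/-- a tensor is symmetric if its entries are invariant under permutations of the indices. -/
def IsSymm' {n m : ℕ} (A : (Fin m → Fin n) → ℝ) : Prop :=
  ∀ (σ : Equiv.Perm (Fin m)) (f : Fin m → Fin n), A (f ∘ σ) = A f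

/-- the objective `φ₀(u,v) = m(m-1)^{1/m−1} v^⊤ u^{[m-1]} − ℬu^m`, `m = k + 2`. -/
noncomputable def phi0 {n k : ℕ} (B : (Fin (k + 2) → Fin n) → ℝ) (u v : Fin n → ℝ) : ℝ :=
  (k + 2 : ℝ) * ((k + 1 : ℝ) ^ ((1 : ℝ) / (k + 2) - 1)) * (∑ i, v i * u i ^ (k + 1)) -
    tEval B u

/-- membership in the feasible set `F = {(u,v) ≥ 0 : 𝒜u^m + ∑ v_i^m = 1}`. -/
noncomputable def Feasible {n k : ℕ} (A : (Fin (k + 2) → Fin n) → ℝ) (u v : Fin n → ℝ) :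
    Prop :=
  (∀ i, 0 ≤ u i) ∧ (∀ i, 0 ≤ v i) ∧ tEval A u + ∑ i, v i ^ (k + 2) = 1

theorem tEval_eq_sum_mul_tApply {n k : ℕ} (A : (Fin (k + 1) → Fin n) → ℝ) (x : Fin n → ℝ) :
    tEval A x = ∑ i, x i * tApply A x i := by
  unfold tEval tApply
  rw [← (Fin.consEquiv (fun _ : Fin (k + 1) => Fin n)).sum_comp, Fintype.sum_prod_type]
  refine Finset.sum_congr rfl fun i _ => ?_
  rw [Finset.mul_sum]
  refine Finset.sum_congr rfl fun g _ => ?_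
  change A (Fin.cons i g) * ∏ j, x ((Fin.cons i g : Fin (k + 1) → Fin n) j) = _
  simp only [Fin.prod_univ_succ, Fin.cons_zero, Fin.cons_succ]
  ring

theorem tApply_unitT {n k : ℕ} (x : Fin n → ℝ) (i : Fin n) :
    tApply (unitT (n := n) (k := k)) x i = x i ^ (k + 1) := by
  unfold tApply unitT
  rw [Finset.sum_eq_single (fun _ => i)]
  · have h : ∀ t : Fin (k + 2), (Fin.cons i (fun _ : Fin (k + 1) => i) : Fin (k + 2) → Fin n) t = i :=
      fun t => by refine Fin.cases ?_ (fun j => ?_) t <;> simp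
    simp [h]
  · intro g _ hg
    rw [if_neg, zero_mul]
    intro h
    exact hg (funext fun j => by simpa using h j.succ)
  · simp

theorem tApply_triple {n k : ℕ} (A B C : (Fin (k + 2) → Fin n) → ℝ) (lam : ℝ)
    (x : Fin n → ℝ) (i : Fin n) :
    tApply (triple A B C lam) x i =
      lam ^ (k + 2) * tApply A x i + lam * tApply B x i + tApply C x i := by
  simp only [tApply, triple, Finset.mul_sum, ← Finset.sum_add_distrib]
  exact Finset.sum_congr rfl fun g _ => by ring

theorem tApply_neg {n k : ℕ} (A : (Fin (k + 1) → Fin n) → ℝ) (x : Fin n → ℝ) (i : Fin n) :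
    tApply (fun f => -A f) x i = -tApply A x i := by
  simp [tApply]

theorem rpow_inv_eq_mul_rpow_inv_sub_one (k : ℕ) :
    (k + 1 : ℝ) ^ ((1 : ℝ) / (k + 2)) = (k + 1) * (k + 1 : ℝ) ^ ((1 : ℝ) / (k + 2) - 1) := by
  have hk : (0 : ℝ) < k + 1 := by positivity
  rw [Real.rpow_sub_one hk.ne']
  field_simp

theorem rpow_inv_pow_mul_rpow_inv_sub_one (k : ℕ) :
    ((k + 1 : ℝ) ^ ((1 : ℝ) / (k + 2))) ^ (k + 1) * (k + 1 : ℝ) ^ ((1 : ℝ) / (k + 2) - 1) = 1 := by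
  have hk : (0 : ℝ) < k + 1 := by positivity
  have hk2 : (k + 2 : ℝ) ≠ 0 := by positivity
  rw [← Real.rpow_mul_natCast hk.le, ← Real.rpow_add hk]
  convert Real.rpow_zero _ using 2
  push_cast
  field_simp
  ring

/-- Every stationary point `(ū, v̄)` of `max {φ₀(u,v) : (u,v) ∈ F}` with `ū ≠ 0` yields the
`m`-degree Pareto-eigenpair `(φ₀(ū,v̄)^{1/(m-1)}, ū)` of `(𝒜, ℬ, −ℐ)`, and
`φ₀(ū,v̄) = −γ̄ > 0`, `m = k + 2`. -/
theorem stationary_point_gives_pareto_eigenpair (k n : ℕ) (hn : 1 ≤ n)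
    (A B : (Fin (k + 2) → Fin n) → ℝ) (hA : IsSymm' A) (hB : IsSymm' B)
    (u v : Fin n → ℝ) (hfeas : Feasible A u v) (hune : u ≠ 0)
    (α β : Fin n → ℝ) (γ : ℝ)
    (heq1 : ∀ i, (k + 2 : ℝ) * tApply B u i -
        (k + 2 : ℝ) * ((k + 1 : ℝ) ^ ((1 : ℝ) / (k + 2))) * (v i * u i ^ k) =
      α i + γ * ((k + 2 : ℝ) * tApply A u i))
    (heq2 : ∀ i, -((k + 2 : ℝ) * ((k + 1 : ℝ) ^ ((1 : ℝ) / (k + 2) - 1)) * u i ^ (k + 1)) =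
      β i + γ * ((k + 2 : ℝ) * v i ^ (k + 1)))
    (hα : ∀ i, 0 ≤ α i) (hαu : ∑ i, α i * u i = 0)
    (hβ : ∀ i, 0 ≤ β i) (hβv : ∑ i, β i * v i = 0) :
    phi0 B u v = -γ ∧ 0 < phi0 B u v ∧
      IsParetoPair A B (fun f => -unitT f) ((phi0 B u v) ^ ((1 : ℝ) / (k + 1))) u := by
  obtain ⟨hu, hv, hF⟩ := hfeas
  have hdc := rpow_inv_eq_mul_rpow_inv_sub_one k
  have hdc1 := rpow_inv_pow_mul_rpow_inv_sub_one k
  have hc : 0 < (k + 1 : ℝ) ^ ((1 : ℝ) / (k + 2) - 1) := by positivity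
  have hd : 0 < (k + 1 : ℝ) ^ ((1 : ℝ) / (k + 2)) := by positivity
  have hm : (0 : ℝ) < k + 2 := by positivity
  have hphi : phi0 B u v = (k + 2 : ℝ) * ((k + 1 : ℝ) ^ ((1 : ℝ) / (k + 2) - 1)) *
    (∑ i, v i * u i ^ (k + 1)) - tEval B u := rfl
  generalize (k + 1 : ℝ) ^ ((1 : ℝ) / (k + 2) - 1) = c at *
  generalize (k + 1 : ℝ) ^ ((1 : ℝ) / (k + 2)) = d at *
  have hαu' : ∀ i, α i * u i = 0 := fun i =>
    (Finset.sum_eq_zero_iff_of_nonneg fun i _ => mul_nonneg (hα i) (hu i)).1 hαu i (mem_univ i)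
  have hβv' : ∀ i, β i * v i = 0 := fun i =>
    (Finset.sum_eq_zero_iff_of_nonneg fun i _ => mul_nonneg (hβ i) (hv i)).1 hβv i (mem_univ i)
  have hsum_u : tEval B u - d * ∑ i, v i * u i ^ (k + 1) = γ * tEval A u := by
    rw [tEval_eq_sum_mul_tApply, tEval_eq_sum_mul_tApply, Finset.mul_sum, Finset.mul_sum,
      ← Finset.sum_sub_distrib]
    refine Finset.sum_congr rfl fun i _ => mul_left_cancel₀ hm.ne' ?_
    linear_combination u i * heq1 i + hαu' i
  have hsum_v : -(c * ∑ i, v i * u i ^ (k + 1)) = γ * ∑ i, v i ^ (k + 2) := by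
    rw [Finset.mul_sum, Finset.mul_sum, ← Finset.sum_neg_distrib]
    refine Finset.sum_congr rfl fun i _ => mul_left_cancel₀ hm.ne' ?_
    linear_combination v i * heq2 i + hβv' i
  have hphiγ : phi0 B u v = -γ := by
    rw [hphi]
    linear_combination -hsum_u - hsum_v - γ * hF - (∑ i, v i * u i ^ (k + 1)) * hdc
  have hγ : γ < 0 := by
    obtain ⟨i, hi⟩ := Function.ne_iff.1 hune
    have hui : 0 < u i := lt_of_le_of_ne (hu i) (Ne.symm hi)
    have hlhs : 0 < (k + 2 : ℝ) * c * u i ^ (k + 1) := by positivity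
    by_contra! hγ0
    have hrhs : 0 ≤ γ * ((k + 2 : ℝ) * v i ^ (k + 1)) :=
      mul_nonneg hγ0 (mul_nonneg hm.le (pow_nonneg (hv i) _))
    linarith [heq2 i, hβ i]
  have hpow : ∀ i, c * u i ^ (k + 1) = -γ * v i ^ (k + 1) := fun i => by
    have hβi : β i = 0 := by
      rcases mul_eq_zero.1 (hβv' i) with h | h
      · exact h
      · have h2 := heq2 i
        rw [h, zero_pow (Nat.succ_ne_zero k)] at h2
        have hlhs : 0 ≤ (k + 2 : ℝ) * c * u i ^ (k + 1) :=
          mul_nonneg (mul_pos hm hc).le (pow_nonneg (hu i) _)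
        linarith [hβ i]
    refine mul_left_cancel₀ hm.ne' ?_
    linear_combination -heq2 i - hβi
  have hpos : 0 < phi0 B u v := by linarith
  refine ⟨hphiγ, hpos, ?_⟩
  have hlam : 0 < phi0 B u v ^ ((1 : ℝ) / (k + 1)) := Real.rpow_pos_of_pos hpos _
  have hlampow : (phi0 B u v ^ ((1 : ℝ) / (k + 1))) ^ (k + 1) = -γ := by
    rw [← hphiγ, ← Real.rpow_mul_natCast hpos.le]
    have hk : (k + 1 : ℝ) ≠ 0 := by positivity
    push_cast
    rw [one_div_mul_cancel hk, Real.rpow_one]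
  generalize phi0 B u v ^ ((1 : ℝ) / (k + 1)) = lam at *
  have hlink : ∀ i, d * v i * lam = u i := fun i => by
    refine (pow_left_inj₀ (mul_nonneg (mul_nonneg hd.le (hv i)) hlam.le) (hu i)
      (Nat.succ_ne_zero k)).1 ?_
    rw [Nat.succ_eq_add_one, mul_pow, mul_pow, hlampow]
    linear_combination (-d ^ (k + 1)) * hpow i + u i ^ (k + 1) * hdc1
  have happ : ∀ i, (k + 2 : ℝ) * tApply (triple A B (fun f => -unitT f) lam) u i = lam * α i :=
    fun i => by
      rw [tApply_triple, tApply_neg, tApply_unitT, pow_succ lam, hlampow]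
      linear_combination lam * heq1 i + (k + 2 : ℝ) * u i ^ k * hlink i
  refine ⟨hune, hu, fun i => ?_, Finset.sum_eq_zero fun i _ => ?_⟩
  · refine nonneg_of_mul_nonneg_right ?_ hm
    rw [happ]
    exact mul_nonneg hlam.le (hα i)
  · refine mul_left_cancel₀ hm.ne' ?_
    linear_combination u i * happ i + lam * hαu' i
end

section
/- Let m ≥ 2 and n ≥ 1 be integers, let 𝒜, ℬ be symmetric m-th order n-dimensional real tensors with 𝒜 copositive, and let (λ̄, x̄) be an m-degree Pareto-eigenpair of (𝒜, ℬ, −ℐ) with λ̄ > 0. Set ȳ = (m-1)^{-1/m} λ̄^{-1} x̄ and (ū, v̄) = (x̄, ȳ) / (𝒜x̄^m + ∑_{i=1}^n ȳ_i^m)^{1/m}. Then 𝒜x̄^m + ∑_{i=1}^n ȳ_i^m > 0, (ū, v̄) lies in the feasible set F, and (ū, v̄) is a stationary point of max{φ₀(u,v) : (u,v) ∈ F}: there exist ᾱ, β̄ ∈ ℝ^n and γ̄ ∈ ℝ with mℬū^{m-1} − m(m-1)^{1/m} diag(v̄)ū^{[m-2]} = ᾱ + γ̄ m 𝒜ū^{m-1},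 −m(m-1)^{1/m − 1} ū^{[m-1]} = β̄ + γ̄ m v̄^{[m-1]}, ᾱ ≥ 0 with ᾱ^⊤ū = 0, and β̄ ≥ 0 with β̄^⊤v̄ = 0 (indeed one may take β̄ = 0 and γ̄ = −λ̄^{m-1}). -/
open Finset

theorem tEval_smul {n m : ℕ} (A : (Fin m → Fin n) → ℝ) (t : ℝ) (x : Fin n → ℝ) :
    tEval A (fun i => t * x i) = t ^ m * tEval A x := by
  simp only [tEval, Finset.prod_mul_distrib, Finset.prod_const, Finset.card_univ,
    Fintype.card_fin, Finset.mul_sum]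
  exact Finset.sum_congr rfl fun f _ => by ring

theorem tApply_smul {n k : ℕ} (A : (Fin (k + 1) → Fin n) → ℝ) (t : ℝ) (x : Fin n → ℝ)
    (i : Fin n) : tApply A (fun i => t * x i) i = t ^ k * tApply A x i := by
  simp only [tApply, Finset.prod_mul_distrib, Finset.prod_const, Finset.card_univ,
    Fintype.card_fin, Finset.mul_sum]
  exact Finset.sum_congr rfl fun f _ => by ring

/-- If `(λ̄, x̄)` is an `m`-degree Pareto-eigenpair of `(𝒜, ℬ, −ℐ)` with `λ̄ > 0`, `𝒜, ℬ`
symmetric and `𝒜` copositive, then the normalized pair `(ū, v̄)` built from `x̄` and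
`ȳ = (m-1)^{-1/m} λ̄^{-1} x̄` is a well-defined feasible stationary point of
`max {φ₀(u,v) : (u,v) ∈ F}` (with multipliers `β̄ = 0`, `γ̄ = −λ̄^{m-1}`), `m = k + 2`. -/
theorem pareto_eigenpair_gives_stationary_point (k n : ℕ) (hn : 1 ≤ n)
    (A B : (Fin (k + 2) → Fin n) → ℝ) (hA : IsSymm' A) (hB : IsSymm' B)
    (hcop : ∀ x : Fin n → ℝ, (∀ i, 0 ≤ x i) → 0 ≤ tEval A x)
    (lam : ℝ) (x : Fin n → ℝ)
    (hpair : IsParetoPair A B (fun f => -unitT f) lam x) (hlam : 0 < lam) :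
    ∀ y u v : Fin n → ℝ,
      y = (fun i => ((k + 1 : ℝ) ^ (-((1 : ℝ) / (k + 2)))) * lam⁻¹ * x i) →
      u = (fun i => x i / (tEval A x + ∑ j, y j ^ (k + 2)) ^ ((1 : ℝ) / (k + 2))) →
      v = (fun i => y i / (tEval A x + ∑ j, y j ^ (k + 2)) ^ ((1 : ℝ) / (k + 2))) →
      0 < tEval A x + ∑ j, y j ^ (k + 2) ∧
      Feasible A u v ∧
      ∃ (α β : Fin n → ℝ) (γ : ℝ),
        (∀ i, (k + 2 : ℝ) * tApply B u i -
            (k + 2 : ℝ) * ((k + 1 : ℝ) ^ ((1 : ℝ) / (k + 2))) * (v i * u i ^ k) =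
          α i + γ * ((k + 2 : ℝ) * tApply A u i)) ∧
        (∀ i, -((k + 2 : ℝ) * ((k + 1 : ℝ) ^ ((1 : ℝ) / (k + 2) - 1)) * u i ^ (k + 1)) =
          β i + γ * ((k + 2 : ℝ) * v i ^ (k + 1))) ∧
        (∀ i, 0 ≤ α i) ∧ (∑ i, α i * u i = 0) ∧
        (∀ i, 0 ≤ β i) ∧ (∑ i, β i * v i = 0) ∧
        β = 0 ∧ γ = -lam ^ (k + 1) := by
  obtain ⟨hx0, hx, hw, hsum⟩ := hpair
  rintro y u v hy hu hv
  have hk : (0 : ℝ) < k + 1 := by positivity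
  have hroot {a : ℝ} (ha : 0 ≤ a) : (a ^ ((1 : ℝ) / (k + 2))) ^ (k + 2) = a := by
    have h := Real.rpow_inv_natCast_pow ha (n := k + 2) (by omega)
    push_cast at h
    rwa [one_div]
  rw [Real.rpow_sub_one hk.ne']
  rw [Real.rpow_neg hk.le] at hy
  have hc : 0 < (k + 1 : ℝ) ^ ((1 : ℝ) / (k + 2)) := Real.rpow_pos_of_pos hk _
  have hcpow := hroot hk.le
  set c : ℝ := (k + 1 : ℝ) ^ ((1 : ℝ) / (k + 2))
  have hynn (i : Fin n) : 0 ≤ y i := by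
    have := hx i
    rw [hy]
    positivity
  have hS : 0 < tEval A x + ∑ j, y j ^ (k + 2) := by
    obtain ⟨i, hi⟩ := Function.ne_iff.mp hx0
    have hxi : 0 < x i := lt_of_le_of_ne (hx i) (Ne.symm hi)
    have hyi : 0 < y i := by rw [hy]; positivity
    exact add_pos_of_nonneg_of_pos (hcop x hx) <|
      Finset.sum_pos' (fun j _ => pow_nonneg (hynn j) _) ⟨i, Finset.mem_univ i, pow_pos hyi _⟩
  have hspow := hroot hS.le
  have hs := Real.rpow_pos_of_pos hS ((1 : ℝ) / (k + 2))
  set S := tEval A x + ∑ j, y j ^ (k + 2) with hSdef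
  set s := S ^ ((1 : ℝ) / (k + 2))
  have hus : u = fun i => s⁻¹ * x i := by
    rw [hu]; funext i; ring
  have hvs : v = fun i => s⁻¹ * y i := by
    rw [hv]; funext i; ring
  have hvu (i : Fin n) : v i = c⁻¹ * lam⁻¹ * u i := by
    rw [hvs, hus, hy]; ring
  have hunn (i : Fin n) : 0 ≤ u i := by
    have := hx i
    rw [hus]
    positivity
  have htriple (i : Fin n) := tApply_triple A B (fun f => -unitT f) lam u i
  simp only [tApply_neg, tApply_unitT] at htriple
  have hTu (i : Fin n) := tApply_smul (triple A B (fun f => -unitT f) lam) s⁻¹ x i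
  rw [← hus] at hTu
  refine ⟨hS, ⟨hunn, fun i => ?_, ?_⟩,
    fun i => (k + 2 : ℝ) * lam⁻¹ * tApply (triple A B (fun f => -unitT f) lam) u i, 0,
    -lam ^ (k + 1), fun i => ?_, fun i => ?_, fun i => ?_, ?_, fun i => le_rfl, by simp, rfl, rfl⟩
  · have := hynn i
    rw [hvs]
    positivity
  · rw [hus, hvs, tEval_smul]
    simp only [mul_pow, ← Finset.mul_sum]
    rw [← mul_add, ← hSdef, inv_pow, hspow, inv_mul_cancel₀ hS.ne']
  · beta_reduce
    rw [htriple, hvu]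
    field_simp
    ring
  · rw [hvu, ← hcpow]
    simp only [Pi.zero_apply, mul_pow, inv_pow]
    field_simp
    ring
  · beta_reduce
    rw [hTu]
    have := hw i
    positivity
  · calc _ = (k + 2 : ℝ) * lam⁻¹ * s⁻¹ ^ (k + 2) *
          ∑ i, x i * tApply (triple A B (fun f => -unitT f) lam) x i := by
          rw [Finset.mul_sum]
          refine Finset.sum_congr rfl fun i _ => ?_
          beta_reduce
          rw [hTu, hus]
          ring
      _ = 0 := by rw [hsum, mul_zero]
end

section
/- Let m ≥ 2 and n ≥ 1 be integers and let 𝒜, ℬ be m-th order n-dimensional real tensors (not necessarily symmetric) with 𝒜 strictly copositive. If the diagonal entries satisfy (a_{ii…i} + 1 − m)(m-1)^{1/m − 1} − b_{ii…i} > 0 for every i ∈ {1,…,n}, then the triplet (𝒜, ℬ, −ℐ) has at least one m-degree Pareto-eigenpair: there exist λ ∈ ℝ and x ∈ ℝ^n \ {0} with x ≥ 0, (λ^m 𝒜 + λ ℬ − ℐ)x^{m-1} ≥ 0 componentwise, and ⟨x, (λ^m 𝒜 + λ ℬ − ℐ)x^{m-1}⟩ = 0. -/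
open Finset

/-- `S` is dominant for the orders `r i` if no point is strictly above the minimum of `S` in all
of them. -/
def Dominant {U I L : Type*} [LE L] (r : I → U → L) (S : Finset U) : Prop :=
  ∀ y, ∃ i, ∀ x ∈ S, r i y ≤ r i x

lemma Dominant.mono {U I L : Type*} [LE L] {r : I → U → L} {S S' : Finset U} (h : Dominant r S) (hs : S' ⊆ S) :
    Dominant r S' := fun y => by
  obtain ⟨i, hi⟩ := h y
  exact ⟨i, fun x hx => hi x (hs hx)⟩

/-- A nonempty dominant set with one element less than there are orders has exactly two dominant
one-point extensions, provided it can be left in each direction. -/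
lemma Dominant.card_extensions {U I L : Type*} [Fintype U] [DecidableEq U] [Fintype I]
    [DecidableEq I] [LinearOrder L] {r : I → U → L} (hr : ∀ i, Function.Injective (r i))
    {S : Finset U} (hS : Dominant r S) (hcard : S.card + 1 = Fintype.card I) (hne : S.Nonempty)
    (hM : ∀ i, ∃ y, ∀ l, l ≠ i → ∃ x ∈ S, r l x < r l y) [DecidablePred (Dominant r)] :
    (univ.filter fun z => z ∉ S ∧ Dominant r (insert z S)).card = 2 := by
  have hg : ∀ l, ∃ x ∈ S, ∀ x' ∈ S, r l x ≤ r l x' := fun l =>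
    S.exists_min_image (r l) hne
  choose g hgS hgmin using hg
  have hguniq : ∀ l, ∀ x ∈ S, (∀ x' ∈ S, r l x ≤ r l x') → g l = x := fun l x hx h =>
    hr l (le_antisymm (hgmin l x hx) (h _ (hgS l)))
  choose f hf using hS
  have hgf : ∀ x ∈ S, g (f x) = x := fun x hx => hguniq _ x hx (hf x)
  have hfinj : Set.InjOn f S := fun x hx x' hx' h => by
    rw [← hgf x hx, ← hgf x' hx', h]
  have hp : ∃ p, p ∉ S.image f := by
    by_contra! h
    have h1 : (S.image f) = univ := eq_univ_iff_forall.2 h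
    have h2 := card_image_of_injOn hfinj
    rw [h1, card_univ] at h2
    omega
  obtain ⟨p, hp⟩ := hp
  set q := f (g p) with hq
  have hgq : g q = g p := hgf _ (hgS p)
  have hpq : p ≠ q := fun h => hp (mem_image.2 ⟨g p, hgS p, h.symm⟩)
  have hX : ∀ i, ∃ x, (∀ l, l ≠ i → r l (g l) < r l x) ∧
      ∀ y, (∀ l, l ≠ i → r l (g l) < r l y) → r i y ≤ r i x := by
    intro i
    obtain ⟨y, hy⟩ := hM i
    have : (univ.filter fun y => ∀ l, l ≠ i → r l (g l) < r l y).Nonempty := by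
      refine ⟨y, mem_filter.2 ⟨mem_univ _, fun l hl => ?_⟩⟩
      obtain ⟨x, hx, hxy⟩ := hy l hl
      exact (hgmin l x hx).trans_lt hxy
    obtain ⟨x, hx, hmax⟩ := exists_max_image _ (r i) this
    exact ⟨x, (mem_filter.1 hx).2, fun y hy => hmax y (mem_filter.2 ⟨mem_univ _, hy⟩)⟩
  choose X hXgt hXmax using hX
  have hXi : ∀ i, ∀ x ∈ S, r i (X i) ≤ r i x := by
    intro i
    by_cases h : f (X i) = i
    · have := hf (X i)
      rwa [h] at this
    · exact absurd (hf (X i) _ (hgS _)) (not_le.2 (hXgt i _ h))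
  have hXdom : ∀ i, Dominant r (insert (X i) S) := by
    intro i y
    by_cases hy : ∀ l, l ≠ i → r l (g l) < r l y
    · refine ⟨i, fun x hx => ?_⟩
      rcases mem_insert.1 hx with rfl | hx
      · exact hXmax i y hy
      · exact (hXmax i y hy).trans (hXi i x hx)
    · push Not at hy
      obtain ⟨l, hl, hly⟩ := hy
      refine ⟨l, fun x hx => ?_⟩
      rcases mem_insert.1 hx with rfl | hx
      · exact hly.trans (hXgt i l hl).le
      · exact hly.trans (hgmin l x hx)
  have hXS : ∀ i, i = p ∨ i = q → X i ∉ S := by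
    intro i hi hmem
    have key : ∀ l, l ≠ i → g l ≠ X i := fun l hl h => by
      have := hXgt i l hl
      rw [h] at this
      exact lt_irrefl _ this
    by_cases h0 : X i = g p
    · rcases hi with rfl | rfl
      · exact key q hpq.symm (hgq.trans h0.symm)
      · exact key p hpq h0.symm
    · refine key (f (X i)) ?_ (hgf _ hmem)
      rcases hi with rfl | rfl
      · exact fun h => hp (mem_image.2 ⟨_, hmem, h⟩)
      · exact fun h => h0 (hfinj hmem (hgS p) h)
  have hXne : X p ≠ X q := by
    intro h
    have h1 : ∀ l, r l (g l) < r l (X p) := fun l => by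
      by_cases hl : l = p
      · rw [h]
        exact hXgt q l (by rw [hl]; exact hpq)
      · exact hXgt p l hl
    exact absurd (hf (X p) _ (hgS _)) (not_le.2 (h1 _))
  have hset : (univ.filter fun z => z ∉ S ∧ Dominant r (insert z S)) = {X p, X q} := by
    ext z
    simp only [mem_filter, mem_univ, true_and, mem_insert, mem_singleton]
    constructor
    · rintro ⟨hzS, hz⟩
      choose f' hf' using hz
      set i := f' z with hi
      have hgf' : ∀ x ∈ S, g (f' x) = x := fun x hx =>
        hguniq _ x hx fun x' hx' => hf' x x' (mem_insert_of_mem hx')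
      have hinj' : Set.InjOn f' S := fun x hx x' hx' h => by
        rw [← hgf' x hx, ← hgf' x' hx', h]
      have hne' : ∀ x ∈ S, f' x ≠ i := fun x hx h => by
        have h1 := hf' x z (mem_insert_self _ _)
        rw [h] at h1
        have h2 := hf' z x (mem_insert_of_mem hx)
        exact hzS (hr i (le_antisymm h1 h2) ▸ hx)
      have himg : S.image f' = univ.erase i := by
        refine eq_of_subset_of_card_le (fun l hl => ?_) ?_
        · obtain ⟨x, hx, rfl⟩ := mem_image.1 hl
          exact mem_erase.2 ⟨hne' x hx, mem_univ _⟩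
        · rw [card_image_of_injOn hinj', card_erase_of_mem (mem_univ _), card_univ]
          omega
      have hsurj : ∀ l, l ≠ i → ∃ x ∈ S, f' x = l := fun l hl => by
        have : l ∈ S.image f' := himg ▸ mem_erase.2 ⟨hl, mem_univ _⟩
        simpa using this
      have hzM : ∀ l, l ≠ i → r l (g l) < r l z := fun l hl => by
        obtain ⟨x, hx, rfl⟩ := hsurj l hl
        rw [hgf' x hx]
        refine lt_of_le_of_ne (hf' x z (mem_insert_self _ _)) fun h => ?_
        exact hzS (hr _ h ▸ hx)
      have hipq : i = p ∨ i = q := by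
        by_contra! h
        obtain ⟨x, hx, hxp⟩ := hsurj p h.1.symm
        obtain ⟨x', hx', hxq⟩ := hsurj q h.2.symm
        have h1 := hgf' x hx
        have h2 := hgf' x' hx'
        rw [hxp] at h1
        rw [hxq, hgq, h1] at h2
        exact hpq (by rw [← hxp, ← hxq, h2])
      have hzX : z = X i := by
        refine hr i (le_antisymm (hXmax i z hzM) ?_)
        by_cases hl : f' (X i) = i
        · have := hf' (X i) z (mem_insert_self _ _)
          rwa [hl] at this
        · exact absurd (hf' (X i) _ (mem_insert_of_mem (hgS _))) (not_le.2 (hXgt i _ hl))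
      rcases hipq with h | h
      · exact Or.inl (h ▸ hzX)
      · exact Or.inr (h ▸ hzX)
    · rintro (rfl | rfl)
      · exact ⟨hXS p (Or.inl rfl), hXdom p⟩
      · exact ⟨hXS q (Or.inr rfl), hXdom q⟩
  rw [hset, card_pair hXne]

/-- A set with as many points as there are colours that misses some colour has an even number of
points whose removal leaves exactly the colours other than `i₀`. -/
lemma even_card_almost_colourful {U I : Type*} [DecidableEq U] [Fintype I] [DecidableEq I]
    (c : U → I) (i₀ : I) {S : Finset U}
    (hcard : S.card = Fintype.card I) (hc : S.image c ≠ univ) :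
    Even (S.filter fun z => (S.erase z).image c = univ.erase i₀).card := by
  rcases (S.filter fun z => (S.erase z).image c = univ.erase i₀).eq_empty_or_nonempty with h | h
  · simp [h]
  obtain ⟨z₁, hz₁⟩ := h
  obtain ⟨hz₁S, himg⟩ := mem_filter.1 hz₁
  have hinj : Set.InjOn c (S.erase z₁) := by
    rw [← card_image_iff, himg, card_erase_of_mem (mem_univ _), card_erase_of_mem hz₁S, hcard,
      card_univ]
  have hcz : c z₁ ≠ i₀ := fun h => hc <| by
    rw [← insert_erase hz₁S, image_insert, himg, h, insert_erase (mem_univ _)]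
  obtain ⟨z₂, hz₂, hcz₂⟩ : ∃ z₂ ∈ S.erase z₁, c z₂ = c z₁ := by
    have : c z₁ ∈ (S.erase z₁).image c := himg ▸ mem_erase.2 ⟨hcz, mem_univ _⟩
    simpa only [mem_image] using this
  have hne : z₁ ≠ z₂ := (mem_erase.1 hz₂).1.symm
  have hset : (S.filter fun z => (S.erase z).image c = univ.erase i₀) = {z₁, z₂} := by
    ext z
    simp only [mem_filter, mem_insert, mem_singleton]
    constructor
    · rintro ⟨hzS, hz⟩
      by_contra! hzz
      have hzmem : z ∈ S.erase z₁ := mem_erase.2 ⟨hzz.1, hzS⟩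
      have : c z ∈ (S.erase z).image c := by
        rw [hz, ← himg]
        exact mem_image_of_mem _ hzmem
      obtain ⟨w, hw, hcw⟩ := mem_image.1 this
      obtain ⟨hwz, hwS⟩ := mem_erase.1 hw
      by_cases hw1 : w = z₁
      · subst hw1
        exact hzz.2 (hinj hzmem hz₂ (by rw [hcz₂, hcw]))
      · exact hwz (hinj (mem_coe.2 (mem_erase.2 ⟨hw1, hwS⟩)) hzmem hcw)
    · rintro (rfl | rfl)
      · exact ⟨hz₁S, himg⟩
      · refine ⟨(mem_erase.1 hz₂).2, ?_⟩
        rw [← himg, ← insert_erase (mem_erase.2 ⟨hne, hz₁S⟩), ← insert_erase hz₂, image_insert,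
          image_insert, hcz₂, erase_right_comm]
  rw [hset, card_pair hne]
  exact even_two

/-- Scarf's lemma: if each order `r i` has a least point `s i`, of colour `i`, which lies above
all points outside the range of `s` in the other orders, then there is a dominant set that uses
every colour exactly once. -/
theorem exists_dominant_colourful {U I L : Type*} [Fintype U] [DecidableEq U] [Fintype I]
    [DecidableEq I] [LinearOrder L] {r : I → U → L} (hr : ∀ i, Function.Injective (r i))
    (s : I → U) (hmin : ∀ i y, r i (s i) ≤ r i y)
    (hmax : ∀ i l, l ≠ i → ∀ t, t ∉ Set.range s → r l t < r l (s i))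
    (hT : ∃ t, t ∉ Set.range s) (c : U → I) (hcs : ∀ i, c (s i) = i) [Nonempty I] :
    ∃ S : Finset U, Dominant r S ∧ S.image c = univ := by
  classical
  by_contra! hno
  obtain ⟨i₀⟩ := ‹Nonempty I›
  have hsinj : Function.Injective s := fun i j h => by rw [← hcs i, h, hcs]
  let D : Finset (Finset U) := univ.filter fun S => Dominant r S ∧
    S.card + 1 = Fintype.card I ∧ S.image c = univ.erase i₀
  let R : Finset (Finset U) := univ.filter fun S => Dominant r S ∧ S.card = Fintype.card I
  have hcount : ∑ S ∈ D, (univ.filter fun z => z ∉ S ∧ Dominant r (insert z S)).card =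
      ∑ S ∈ R, (S.filter fun z => (S.erase z).image c = univ.erase i₀).card := by
    rw [← card_sigma, ← card_sigma]
    refine card_bij' (fun a _ => ⟨insert a.2 a.1, a.2⟩) (fun a _ => ⟨a.1.erase a.2, a.2⟩)
      ?_ ?_ ?_ ?_
    · rintro ⟨S, z⟩ h
      simp only [mem_sigma, D, R, mem_filter, mem_univ, true_and] at h ⊢
      obtain ⟨⟨h1, h2, h3⟩, h4, h5⟩ := h
      refine ⟨⟨h5, by rw [card_insert_of_notMem h4, h2]⟩, mem_insert_self _ _, ?_⟩
      rw [erase_insert h4, h3]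
    · rintro ⟨S, z⟩ h
      simp only [mem_sigma, D, R, mem_filter, mem_univ, true_and] at h ⊢
      obtain ⟨⟨h1, h2⟩, h3, h4⟩ := h
      refine ⟨⟨h1.mono (erase_subset _ _), by rw [card_erase_add_one h3, h2], h4⟩,
        notMem_erase _ _, ?_⟩
      rwa [insert_erase h3]
    · rintro ⟨S, z⟩ h
      simp only [mem_sigma, D, mem_filter, mem_univ, true_and] at h
      simp [erase_insert h.2.1]
    · rintro ⟨S, z⟩ h
      simp only [mem_sigma, R, mem_filter, mem_univ, true_and] at h
      simp [insert_erase h.2.1]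
  have heven : Even (∑ S ∈ R, (S.filter fun z => (S.erase z).image c = univ.erase i₀).card) := by
    refine even_sum _ fun S hS => ?_
    obtain ⟨h1, h2⟩ := (mem_filter.1 hS).2
    exact even_card_almost_colourful c i₀ h2 (hno S h1)
  let S₀ : Finset U := (univ.erase i₀).image s
  have hS₀D : S₀ ∈ D := by
    refine mem_filter.2 ⟨mem_univ _, fun y => ?_, ?_, ?_⟩
    · by_cases hy : y ∈ Set.range s
      · obtain ⟨i, rfl⟩ := hy
        exact ⟨i, fun x _ => hmin i x⟩
      · refine ⟨i₀, fun x hx => ?_⟩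
        obtain ⟨i, hi, rfl⟩ := mem_image.1 hx
        exact (hmax i i₀ (mem_erase.1 hi).1.symm y hy).le
    · rw [card_image_of_injective _ hsinj, card_erase_add_one (mem_univ _), card_univ]
    · rw [image_image]
      rw [show c ∘ s = id from funext hcs, image_id]
  have hS₀ : (univ.filter fun z => z ∉ S₀ ∧ Dominant r (insert z S₀)).card = 1 := by
    obtain ⟨t, ht⟩ := hT
    obtain ⟨w, hw, hwmax⟩ := exists_max_image (univ.filter fun t => t ∉ Set.range s) (r i₀)
      ⟨t, by simpa using ht⟩
    simp only [mem_filter, mem_univ, true_and] at hw hwmax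
    have hlt : ∀ l, ∀ y, y ∉ Set.range s → r l (s l) < r l y := fun l y hy =>
      lt_of_le_of_ne (hmin l y) fun h => hy ⟨l, hr l h⟩
    have hmem : ∀ l, l ≠ i₀ → s l ∈ S₀ := fun l hl =>
      mem_image.2 ⟨l, mem_erase.2 ⟨hl, mem_univ _⟩, rfl⟩
    rw [card_eq_one]
    refine ⟨w, ?_⟩
    ext z
    simp only [mem_filter, mem_univ, true_and, mem_singleton]
    constructor
    · rintro ⟨hz, hdom⟩
      have key : ∀ y, y ∉ Set.range s → r i₀ y ≤ r i₀ z := fun y hy => by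
        obtain ⟨i, hi⟩ := hdom y
        by_cases hii : i = i₀
        · exact hii ▸ hi z (mem_insert_self _ _)
        · exact absurd (hi _ (mem_insert_of_mem (hmem i hii))) (not_le.2 (hlt i y hy))
      have hzr : z ∉ Set.range s := by
        rintro ⟨i, rfl⟩
        by_cases hii : i = i₀
        · subst hii
          exact absurd (key w hw) (not_le.2 (hlt _ w hw))
        · exact hz (hmem i hii)
      exact hr i₀ (le_antisymm (hwmax z hzr) (key w hw))
    · rintro rfl
      refine ⟨fun h => ?_, fun y => ?_⟩
      · obtain ⟨i, -, rfl⟩ := mem_image.1 h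
        exact hw ⟨i, rfl⟩
      · by_cases hy : y ∈ Set.range s
        · obtain ⟨i, rfl⟩ := hy
          exact ⟨i, fun x _ => hmin i x⟩
        · refine ⟨i₀, fun x hx => ?_⟩
          rcases mem_insert.1 hx with rfl | hx
          · exact hwmax y hy
          · obtain ⟨i, hi, rfl⟩ := mem_image.1 hx
            exact (hmax i i₀ (mem_erase.1 hi).1.symm y hy).le
  have hother : ∀ S ∈ D.erase S₀,
      Even (univ.filter fun z => z ∉ S ∧ Dominant r (insert z S)).card := by
    intro S hS
    obtain ⟨hne, hSD⟩ := mem_erase.1 hS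
    obtain ⟨h1, h2, h3⟩ := (mem_filter.1 hSD).2
    obtain ⟨t, htS, ht⟩ : ∃ t ∈ S, t ∉ Set.range s := by
      by_contra! hsub
      refine hne (eq_of_subset_of_card_le (fun x hx => ?_) ?_)
      · obtain ⟨i, rfl⟩ := hsub x hx
        refine mem_image_of_mem _ ?_
        have := mem_image_of_mem c hx
        rwa [h3, hcs] at this
      · have := (mem_filter.1 hS₀D).2.2.1
        omega
    rw [h1.card_extensions hr h2 ⟨t, htS⟩ fun i => ⟨s i, fun l hl => ⟨t, htS, hmax i l hl t ht⟩⟩]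
    exact even_two
  rw [← hcount, ← add_sum_erase _ _ hS₀D, hS₀] at heven
  have := even_sum _ hother
  rw [Nat.even_add] at heven
  exact Nat.not_even_one (heven.2 this)

/-- A discrete form of the Knaster–Kuratowski–Mazurkiewicz covering theorem. -/
lemma exists_approx_solution_stdSimplex {I : Type*} [Fintype I] [Nonempty I]
    (F : (I → ℝ) → I → ℝ) {N : ℕ} (hN : 0 < N) :
    ∃ x ∈ stdSimplex ℝ I, ∀ i, x i ≤ Fintype.card I / N ∨ ∃ p ∈ stdSimplex ℝ I,
      (∀ j, |p j - x j| ≤ Fintype.card I / N) ∧ ∀ j, F p i ≤ F p j := by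
  classical
  have hN' : (0 : ℝ) < N := Nat.cast_pos.2 hN
  let T := {x : I → ℕ // x ∈ piAntidiag univ N}
  have : Fintype T := Finset.fintypeCoeSort _
  have hTsum : ∀ t : T, ∑ i, t.1 i = N := fun t => (mem_piAntidiag.1 t.2).1
  have hTmk : ∀ y : I → ℕ, ∑ i, y i = N → y ∈ piAntidiag univ N := fun y hy =>
    mem_piAntidiag.2 ⟨hy, fun i _ => mem_univ i⟩
  let pt : T → I → ℝ := fun t i => t.1 i / N
  have hpt : ∀ t, pt t ∈ stdSimplex ℝ I := fun t => by
    refine ⟨fun i => by positivity, ?_⟩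
    rw [← sum_div, ← Nat.cast_sum, hTsum, div_self hN'.ne']
  have hcol : ∀ t : T, ∃ i, ∀ j, F (pt t) i ≤ F (pt t) j := fun t => Finite.exists_min _
  choose col hcol using hcol
  let a : I → T ⊕ I → ℕ := fun i => Sum.elim (fun t => t.1 i + 1)
    (fun j => if j = i then 0 else N + 2)
  let e := Fintype.equivFin (T ⊕ I)
  let r : I → T ⊕ I → ℕ ×ₗ Fin (Fintype.card (T ⊕ I)) := fun i u => toLex (a i u, e u)
  have hr : ∀ i, Function.Injective (r i) := fun i u v h =>
    e.injective (Prod.ext_iff.1 (toLex.injective h)).2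
  have hlt : ∀ i u v, a i u < a i v → r i u < r i v := fun i u v h =>
    Prod.Lex.toLex_lt_toLex.2 (Or.inl h)
  have hle : ∀ i u v, r i u ≤ r i v → a i u ≤ a i v := fun i u v h =>
    not_lt.1 fun h' => absurd h (not_le.2 (hlt i v u h'))
  have hTle : ∀ (t : T) i, t.1 i ≤ N := fun t i =>
    (single_le_sum (f := t.1) (fun _ _ => Nat.zero_le _) (mem_univ i)).trans_eq (hTsum t)
  obtain ⟨i₀⟩ := ‹Nonempty I›
  let y₀ : T := ⟨Pi.single i₀ N, hTmk _ (by simp)⟩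
  obtain ⟨S, hdom, hS⟩ := exists_dominant_colourful hr Sum.inr
    (by
      rintro i (t | j)
      · exact (hlt _ _ _ (by simp [a])).le
      · by_cases hj : j = i
        · rw [hj]
        · exact (hlt _ _ _ (by simp [a, hj])).le)
    (by
      rintro i l hl (t | j) ht
      · refine hlt _ _ _ ?_
        simp only [a, Sum.elim_inl, Sum.elim_inr, if_neg hl.symm]
        have := hTle t l
        omega
      · exact absurd ⟨j, rfl⟩ ht)
    ⟨Sum.inl y₀, by simp⟩ (Sum.elim col id) (fun i => rfl)
  have hcell : ∀ y : T, ∃ i, Sum.inr i ∉ S ∧ ∀ t : T, Sum.inl t ∈ S → y.1 i ≤ t.1 i := fun y => by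
    obtain ⟨i, hi⟩ := hdom (Sum.inl y)
    refine ⟨i, fun h => ?_, fun t ht => ?_⟩
    · have := hle _ _ _ (hi _ h)
      simp [a] at this
    · have := hle _ _ _ (hi _ ht)
      simpa [a] using this
  have hcolS : ∀ i, Sum.inr i ∈ S ∨ ∃ t : T, Sum.inl t ∈ S ∧ col t = i := fun i => by
    obtain ⟨u, hu, hui⟩ := mem_image.1 (hS.symm ▸ mem_univ i : i ∈ S.image (Sum.elim col id))
    rcases u with t | j
    · exact Or.inr ⟨t, hu, hui⟩
    · have hj : j = i := hui
      exact Or.inl (hj ▸ hu)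
  obtain ⟨t₀, ht₀⟩ : ∃ t : T, Sum.inl t ∈ S := by
    obtain ⟨i, hi, -⟩ := hcell y₀
    rcases hcolS i with h | ⟨t, ht, -⟩
    · exact absurd h hi
    · exact ⟨t, ht⟩
  have hmin : ∀ i, ∃ t : T, Sum.inl t ∈ S ∧ ∀ t' : T, Sum.inl t' ∈ S → t.1 i ≤ t'.1 i := fun i => by
    obtain ⟨t, ht, htm⟩ := exists_min_image (univ.filter fun t : T => Sum.inl t ∈ S)
      (fun t => t.1 i) ⟨t₀, by simpa using ht₀⟩
    exact ⟨t, by simpa using ht, fun t' ht' => htm t' (by simpa using ht')⟩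
  choose τ hτS hτ using hmin
  let μ : I → ℕ := fun i => if Sum.inr i ∈ S then 0 else (τ i).1 i
  have hμle : ∀ t : T, Sum.inl t ∈ S → ∀ i, μ i ≤ t.1 i := fun t ht i => by
    by_cases hi : Sum.inr i ∈ S
    · simp [μ, hi]
    · simpa [μ, hi] using hτ i t ht
  have hμsum : N ≤ ∑ i, μ i + Fintype.card I := by
    by_contra! hlt
    let y : I → ℕ := fun i => μ i + 1 + if i = i₀ then N - (∑ i, μ i + Fintype.card I) else 0
    have hy : ∑ i, y i = N := by
      simp only [y, sum_add_distrib, sum_ite_eq', mem_univ, if_true, sum_const, card_univ,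
        smul_eq_mul, mul_one]
      omega
    obtain ⟨i, hi, hyi⟩ := hcell ⟨y, hTmk y hy⟩
    have h1 := hyi (τ i) (hτS i)
    have h2 : μ i = (τ i).1 i := if_neg hi
    have h3 : μ i + 1 ≤ y i := Nat.le_add_right _ _
    simp only at h1
    omega
  have hup : ∀ t : T, Sum.inl t ∈ S → ∀ i, t.1 i ≤ μ i + Fintype.card I := fun t ht i => by
    have h1 := hTsum t
    rw [← add_sum_erase _ _ (mem_univ i)] at h1 hμsum
    have h2 : ∑ j ∈ univ.erase i, μ j ≤ ∑ j ∈ univ.erase i, t.1 j :=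
      sum_le_sum fun j _ => hμle t ht j
    omega
  refine ⟨pt t₀, hpt t₀, fun i => ?_⟩
  rcases hcolS i with hi | ⟨t, ht, rfl⟩
  · left
    have h1 := hup t₀ ht₀ i
    have h2 : μ i = 0 := if_pos hi
    rw [h2, zero_add] at h1
    exact div_le_div_of_nonneg_right (Nat.cast_le.2 h1) hN'.le
  · refine Or.inr ⟨pt t, hpt t, fun j => ?_, hcol t⟩
    have h1 : (t.1 j : ℝ) ≤ μ j + Fintype.card I := by exact_mod_cast hup t ht j
    have h2 : (t₀.1 j : ℝ) ≤ μ j + Fintype.card I := by exact_mod_cast hup t₀ ht₀ j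
    have h3 : (μ j : ℝ) ≤ t.1 j := by exact_mod_cast hμle t ht j
    have h4 : (μ j : ℝ) ≤ t₀.1 j := by exact_mod_cast hμle t₀ ht₀ j
    rw [← sub_div, abs_div, abs_of_pos hN']
    refine div_le_div_of_nonneg_right (abs_le.2 ⟨?_, ?_⟩) hN'.le <;> linarith

/-- Every continuous map on the standard simplex has a solution of its variational inequality. -/
theorem exists_solution_stdSimplex {I : Type*} [Fintype I] [Nonempty I]
    {F : (I → ℝ) → I → ℝ} (hF : ContinuousOn F (stdSimplex ℝ I)) :
    ∃ x ∈ stdSimplex ℝ I, ∀ i, 0 < x i → ∀ j, F x i ≤ F x j := by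
  choose u hu hui using fun N : ℕ => exists_approx_solution_stdSimplex F N.succ_pos
  obtain ⟨x, hx, φ, hφ, hlim⟩ := (isCompact_stdSimplex ℝ I).tendsto_subseq hu
  refine ⟨x, hx, fun i hi j => ?_⟩
  have hδ : Filter.Tendsto (fun N : ℕ => (Fintype.card I : ℝ) / ((φ N).succ : ℕ)) Filter.atTop
      (nhds 0) :=
    ((tendsto_const_div_atTop_nhds_zero_nat (Fintype.card I : ℝ)).comp
      (Filter.tendsto_add_atTop_nat 1)).comp hφ.tendsto_atTop
  have hui' : ∀ N, ∃ p ∈ stdSimplex ℝ I, ((Fintype.card I : ℝ) / ((φ N).succ : ℕ) < u (φ N) i →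
      (∀ l, |p l - u (φ N) l| ≤ (Fintype.card I : ℝ) / ((φ N).succ : ℕ)) ∧ F p i ≤ F p j) := by
    intro N
    rcases hui (φ N) i with h | ⟨p, hp, h1, h2⟩
    · exact ⟨x, hx, fun h' => absurd h (not_le.2 h')⟩
    · exact ⟨p, hp, fun _ => ⟨h1, h2 j⟩⟩
  choose p hp hpu using hui'
  have hlimi : ∀ l, Filter.Tendsto (fun N => u (φ N) l) Filter.atTop (nhds (x l)) :=
    tendsto_pi_nhds.1 hlim
  have hev : ∀ᶠ N in Filter.atTop, (Fintype.card I : ℝ) / ((φ N).succ : ℕ) < u (φ N) i :=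
    hδ.eventually_lt (hlimi i) hi
  have hpx : Filter.Tendsto p Filter.atTop (nhds x) := by
    refine tendsto_pi_nhds.2 fun l => ?_
    have h0 : Filter.Tendsto (fun N => p N l - u (φ N) l) Filter.atTop (nhds 0) :=
      squeeze_zero_norm' (hev.mono fun N hN => (hpu N hN).1 l) hδ
    simpa using h0.add (hlimi l)
  have hFp : Filter.Tendsto (fun N => F (p N)) Filter.atTop (nhds (F x)) :=
    (hF x hx).tendsto.comp
      (tendsto_nhdsWithin_iff.2 ⟨hpx, Filter.Eventually.of_forall hp⟩)
  exact le_of_tendsto_of_tendsto (tendsto_pi_nhds.1 hFp i) (tendsto_pi_nhds.1 hFp j)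
    (hev.mono fun N hN => (hpu N hN).2)

lemma pow_mul_add_lt_of_lt {k : ℕ} {a b c μ ν : ℝ} (ha : 0 < a) (hc : 0 < c) (hμ : 0 < μ)
    (hμν : μ < ν) (h : ν ^ (k + 2) * a + ν * b ≤ c) : μ ^ (k + 2) * a + μ * b < c := by
  have hν : 0 < ν := hμ.trans hμν
  have hpow : μ ^ (k + 1) ≤ ν ^ (k + 1) := pow_le_pow_left₀ hμ.le hμν.le _
  refine lt_of_mul_lt_mul_left ?_ hν.le
  calc ν * (μ ^ (k + 2) * a + μ * b) = μ * (ν * (μ ^ (k + 1) * a) + ν * b) := by ring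
    _ ≤ μ * (ν * (ν ^ (k + 1) * a) + ν * b) := by gcongr
    _ = μ * (ν ^ (k + 2) * a + ν * b) := by ring
    _ ≤ μ * c := by gcongr
    _ < ν * c := by gcongr

lemma exists_pos_root (k : ℕ) {a c : ℝ} (b : ℝ) (ha : 0 < a) (hc : 0 < c) :
    ∃ l, 0 < l ∧ l ^ (k + 2) * a + l * b = c := by
  set M : ℝ := 1 + (|b| + c) / a with hM
  have hM1 : 1 ≤ M := by
    have : 0 ≤ (|b| + c) / a := by positivity
    linarith
  have hMa : M * a = a + |b| + c := by
    rw [hM]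
    field_simp
    ring
  have hpow : M ≤ M ^ (k + 1) := le_self_pow₀ hM1 (Nat.succ_ne_zero k)
  have hbig : c ≤ M ^ (k + 2) * a + M * b := by
    have h1 : c ≤ M ^ (k + 1) * a + b := by
      have := mul_le_mul_of_nonneg_right hpow ha.le
      linarith [neg_abs_le b]
    calc c ≤ M * c := le_mul_of_one_le_left hc.le hM1
      _ ≤ M * (M ^ (k + 1) * a + b) := by gcongr
      _ = M ^ (k + 2) * a + M * b := by ring
  have hcont : ContinuousOn (fun l : ℝ => l ^ (k + 2) * a + l * b) (Set.Icc 0 M) := by fun_prop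
  obtain ⟨l, hl, hlc⟩ := intermediate_value_Icc (zero_le_one.trans hM1) hcont
    (⟨by simpa using hc.le, hbig⟩ : c ∈ Set.Icc _ _)
  refine ⟨l, lt_of_le_of_ne hl.1 ?_, hlc⟩
  rintro rfl
  simp at hlc
  exact hc.ne hlc

lemma continuousOn_pos_root {X : Type*} [TopologicalSpace X] {s : Set X} {k : ℕ}
    {a b c l : X → ℝ} (ha : ContinuousOn a s) (hb : ContinuousOn b s) (hc : ContinuousOn c s)
    (ha0 : ∀ x ∈ s, 0 < a x) (hc0 : ∀ x ∈ s, 0 < c x) (hl0 : ∀ x ∈ s, 0 < l x)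
    (hl : ∀ x ∈ s, l x ^ (k + 2) * a x + l x * b x = c x) : ContinuousOn l s := by
  intro x hx
  have hval : ∀ μ : ℝ, Filter.Tendsto (fun x => μ ^ (k + 2) * a x + μ * b x) (nhdsWithin x s)
      (nhds (μ ^ (k + 2) * a x + μ * b x)) := fun μ =>
    ((ha x hx).const_mul _).add ((hb x hx).const_mul _)
  refine tendsto_order.2 ⟨fun μ hμ => ?_, fun μ hμ => ?_⟩
  · rcases le_or_gt μ 0 with h0 | h0
    · filter_upwards [self_mem_nhdsWithin] with y hy using h0.trans_lt (hl0 y hy)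
    · have := pow_mul_add_lt_of_lt (ha0 x hx) (hc0 x hx) h0 hμ (hl x hx).le
      filter_upwards [self_mem_nhdsWithin, (hval μ).eventually_lt (hc x hx) this] with y hy hlt
      by_contra! hle
      rcases hle.eq_or_lt with heq | hlt'
      · rw [← heq, hl y hy] at hlt
        exact lt_irrefl _ hlt
      · exact (pow_mul_add_lt_of_lt (ha0 y hy) (hc0 y hy) (hl0 y hy) hlt' hlt.le).ne (hl y hy)
  · have : c x < μ ^ (k + 2) * a x + μ * b x := by
      by_contra! hle
      exact (pow_mul_add_lt_of_lt (ha0 x hx) (hc0 x hx) (hl0 x hx) hμ hle).ne (hl x hx)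
    filter_upwards [self_mem_nhdsWithin, (hc x hx).eventually_lt (hval μ) this] with y hy hlt
    by_contra! hle
    rcases hle.eq_or_lt with heq | hlt'
    · rw [heq, hl y hy] at hlt
      exact lt_irrefl _ hlt
    · have h0 : 0 < μ := (hl0 x hx).trans hμ
      exact lt_asymm hlt (pow_mul_add_lt_of_lt (ha0 y hy) (hc0 y hy) h0 hlt' (hl y hy).le)

lemma sum_mul_tApply {n k : ℕ} (A : (Fin (k + 1) → Fin n) → ℝ) (x : Fin n → ℝ) :
    ∑ i, x i * tApply A x i = tEval A x := by
  unfold tEval tApply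
  rw [← (Fin.consEquiv fun _ => Fin n).sum_comp, Fintype.sum_prod_type]
  refine sum_congr rfl fun i _ => ?_
  rw [mul_sum]
  refine sum_congr rfl fun g _ => ?_
  simp only [Fin.consEquiv, Equiv.coe_fn_mk, Fin.prod_univ_succ, Fin.cons_zero, Fin.cons_succ]
  ring

lemma tEval_triple {n k : ℕ} (A B C : (Fin (k + 2) → Fin n) → ℝ) (lam : ℝ) (x : Fin n → ℝ) :
    tEval (triple A B C lam) x = lam ^ (k + 2) * tEval A x + lam * tEval B x + tEval C x := by
  simp only [tEval, triple, mul_sum, ← sum_add_distrib]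
  exact sum_congr rfl fun f _ => by ring

lemma tEval_neg {n m : ℕ} (A : (Fin m → Fin n) → ℝ) (x : Fin n → ℝ) :
    tEval (fun f => -A f) x = -tEval A x := by
  simp [tEval]

lemma tEval_unitT_pos {n k : ℕ} {x : Fin n → ℝ} (hx : ∀ i, 0 ≤ x i) (hx0 : x ≠ 0) :
    0 < tEval (unitT (n := n) (k := k)) x := by
  obtain ⟨i, hi⟩ := Function.ne_iff.1 hx0
  have hi : 0 < x i := lt_of_le_of_ne (hx i) (Ne.symm hi)
  refine sum_pos' (fun f _ => mul_nonneg ?_ (prod_nonneg fun j _ => hx _))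
    ⟨fun _ => i, mem_univ _, ?_⟩
  · unfold unitT
    split_ifs <;> norm_num
  · simp only [unitT, implies_true, if_true, prod_const, one_mul]
    positivity

lemma continuous_tEval {n m : ℕ} (A : (Fin m → Fin n) → ℝ) : Continuous (tEval A) := by
  unfold tEval
  fun_prop

/-- Existence without symmetry: if `𝒜` is strictly copositive and
`(a_{i…i} + 1 − m)(m-1)^{1/m − 1} − b_{i…i} > 0` for all `i`, then `(𝒜, ℬ, −ℐ)` has at least
one `m`-degree Pareto-eigenpair, `m = k + 2`. -/
theorem asymmetric_existence_negI (k n : ℕ) (hn : 1 ≤ n)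
    (A B : (Fin (k + 2) → Fin n) → ℝ)
    (hscop : ∀ x : Fin n → ℝ, (∀ i, 0 ≤ x i) → x ≠ 0 → 0 < tEval A x)
    (hdiag : ∀ i : Fin n,
      0 < (A (fun _ => i) + 1 - (k + 2 : ℝ)) * ((k + 1 : ℝ) ^ ((1 : ℝ) / (k + 2) - 1)) -
        B (fun _ => i)) :
    ∃ (lam : ℝ) (x : Fin n → ℝ), IsParetoPair A B (fun f => -unitT f) lam x := by
  have : Nonempty (Fin n) := ⟨⟨0, hn⟩⟩
  have hne : ∀ x ∈ stdSimplex ℝ (Fin n), x ≠ 0 := by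
    rintro x hx rfl
    simpa using hx.2
  have hA : ∀ x ∈ stdSimplex ℝ (Fin n), 0 < tEval A x := fun x hx => hscop x hx.1 (hne x hx)
  have hI : ∀ x ∈ stdSimplex ℝ (Fin n), 0 < tEval (unitT (n := n) (k := k)) x := fun x hx =>
    tEval_unitT_pos hx.1 (hne x hx)
  have hroot : ∀ x, ∃ l : ℝ, x ∈ stdSimplex ℝ (Fin n) →
      0 < l ∧ l ^ (k + 2) * tEval A x + l * tEval B x = tEval (unitT (n := n) (k := k)) x := by
    intro x
    by_cases hx : x ∈ stdSimplex ℝ (Fin n)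
    · obtain ⟨l, hl⟩ := exists_pos_root k (tEval B x) (hA x hx) (hI x hx)
      exact ⟨l, fun _ => hl⟩
    · exact ⟨0, fun h => absurd h hx⟩
  choose l hl using hroot
  have hlcont : ContinuousOn l (stdSimplex ℝ (Fin n)) :=
    continuousOn_pos_root (continuous_tEval A).continuousOn (continuous_tEval B).continuousOn
      (continuous_tEval unitT).continuousOn hA hI (fun x hx => (hl x hx).1)
      fun x hx => (hl x hx).2
  let F : (Fin n → ℝ) → Fin n → ℝ := fun x => tApply (triple A B (fun f => -unitT f) (l x)) x
  have hF : ContinuousOn F (stdSimplex ℝ (Fin n)) := by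
    refine continuousOn_pi.2 fun i => ?_
    simp only [F, tApply, triple]
    fun_prop
  obtain ⟨x, hx, hsol⟩ := exists_solution_stdSimplex hF
  have hsum : ∑ i, x i * F x i = 0 := by
    rw [sum_mul_tApply, tEval_triple, tEval_neg, (hl x hx).2, add_neg_cancel]
  refine ⟨l x, x, hne x hx, hx.1, fun j => ?_, hsum⟩
  calc (0 : ℝ) = ∑ i, x i * F x i := hsum.symm
    _ ≤ ∑ i, x i * F x j := by
      refine sum_le_sum fun i _ => ?_
      rcases (hx.1 i).eq_or_lt with h | h
      · rw [← h, zero_mul, zero_mul]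
      · exact mul_le_mul_of_nonneg_left (hsol i h j) h.le
    _ = F x j := by rw [← sum_mul, hx.2, one_mul]
end
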